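/- Let p, q, r ∈ (1,∞) satisfy 1/p + 1/q + 1/r = 1 and p ≥ q, and let 𝒮 := {p−2, q−2, r−2, 1, q(1−2/p), r(1−2/p), p/q, q/p}. Then max 𝒮 = max{p,r} − 2 and min 𝒮 = min{q,r} − 2. -/

import Mathlib

/-- Lemma: extremal elements of the family `𝒮` of exponents
associated with a Hölder triple `p ≥ q`. -/
theorem holder_triple_exponent_family_S (p q r : ℝ) (hp : 1 < p) (hq : 1 < q)
    (hr : 1 < r) (hqp : q ≤ p) (hpqr : 1 / p + 1 / q + 1 / r = 1) :
    max (p - 2) (max (q - 2) (max (r - 2) (max 1 (max (q * (1 - 2 / p))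
        (max (r * (1 - 2 / p)) (max (p / q) (q / p))))))) =
      max p r - 2 ∧
    min (p - 2) (min (q - 2) (min (r - 2) (min 1 (min (q * (1 - 2 / p))
        (min (r * (1 - 2 / p)) (min (p / q) (q / p))))))) =
      min q r - 2 := by
  have hp0 : 0 < p := by linarith
  have hq0 : 0 < q := by linarith
  have hr0 : 0 < r := by linarith
  have expand (x : ℝ) : x / p + x / q + x / r = x := by
    linear_combination x * hpqr
  have ep := expand p
  have eq := expand q
  have er := expand r
  rw [div_self hp0.ne'] at ep
  rw [div_self hq0.ne'] at eq
  rw [div_self hr0.ne'] at er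
  have hv1 : q / p ≤ 1 := (div_le_one hp0).2 hqp
  have hu1 : 1 ≤ p / q := (one_le_div hq0).2 hqp
  have ht : 0 ≤ 1 - 2 / p := by
    have h1 : 1 / p ≤ 1 / q := one_div_le_one_div_of_le hq0 hqp
    have h2 : 0 < 1 / r := by positivity
    have h3 : 2 / p = 2 * (1 / p) := by ring
    linarith
  have hupper : p / q ≤ max p r - 2 := by
    rcases le_total r p with h | h
    · rw [max_eq_left h]
      have := (one_le_div hr0).2 h
      linarith
    · rw [max_eq_right h]
      have := (one_le_div hp0).2 h
      have : p / q ≤ r / q := by gcongr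
      linarith
  have hlower : min q r - 2 ≤ q / p := by
    rcases le_total q r with h | h
    · rw [min_eq_left h]
      have := (div_le_one hr0).2 h
      linarith
    · rw [min_eq_right h]
      have := (div_le_one hq0).2 h
      have : r / p ≤ q / p := by gcongr
      linarith
  have mul_le (x : ℝ) (hx : x ≤ max p r) : x * (1 - 2 / p) ≤ max p r - 2 := by
    have h1 := mul_le_mul_of_nonneg_right hx ht
    have h2 := (one_le_div hp0).2 (le_max_left p r)
    have h3 : max p r * (1 - 2 / p) = max p r - 2 * (max p r / p) := by ring
    linarith
  have le_mul (x : ℝ) (hx : min q r ≤ x) : min q r - 2 ≤ x * (1 - 2 / p) := by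
    have h1 := mul_le_mul_of_nonneg_right hx ht
    have h2 := (div_le_one hp0).2 ((min_le_left q r).trans hqp)
    have h3 : min q r * (1 - 2 / p) = min q r - 2 * (min q r / p) := by ring
    linarith
  have hpm := le_max_left p r
  have hrm := le_max_right p r
  have hnq := min_le_left q r
  have hnr := min_le_right q r
  constructor
  · apply le_antisymm
    · have h1 := mul_le q (hqp.trans hpm)
      have h2 := mul_le r hrm
      simp only [max_le_iff]
      refine ⟨?_, ?_, ?_, ?_, h1, h2, hupper, ?_⟩ <;> linarith
    · rw [← max_sub_sub_right]
      exact max_le_max le_rfl ((le_max_left _ _).trans (le_max_right _ _))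
  · apply le_antisymm
    · rw [← min_sub_sub_right]
      exact (min_le_right _ _).trans (min_le_min le_rfl (min_le_left _ _))
    · have h1 := le_mul q hnq
      have h2 := le_mul r hnr
      simp only [le_min_iff]
      refine ⟨?_, ?_, ?_, ?_, h1, h2, ?_, hlower⟩ <;> linarith
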